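/- arXiv:2205.11000 — 2 statements merged into one kernel-verified Lean document; each statement's English description precedes it below -/
import Mathlib

section
/- For every f ∈ W, Af is partially differentiable with respect to both T and x on D, and the first-order partial derivatives (Af)_T and (Af)_x are continuous on D, so that Af ∈ C¹(D); moreover, at T = T_c the T-derivative is given by (Af)_T(T_c, x) = −( ∫_I U(x,ξ) (√(−f_T(T_c,ξ)) / ξ) tanh(ξ/(2T_c)) dξ )². -/
open Set MeasureTheory Filter Topology

noncomputable section

/-- The context of the BCS-Bogoliubov model: the cutoff `eps`, the Debye energy `om = ℏω_D`,
the potential `U` with bounds `U₁ ≤ U ≤ U₂`, the constant `a`, the temperatures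
`tau₁, tau₂, T₀, Tc`, the solutions `Δ₁, Δ₂` of the constant-potential gap equations,
the constant `Mz = max_{z ≥ 0} z / cosh z` and the constant `MT = M_T`. -/
structure BCSContext where
  eps : ℝ
  om : ℝ
  U : ℝ → ℝ → ℝ
  U₁ : ℝ
  U₂ : ℝ
  Umax : ℝ
  Umin : ℝ
  a : ℝ
  tau₁ : ℝ
  tau₂ : ℝ
  Δ₁ : ℝ → ℝ
  Δ₂ : ℝ → ℝ
  Tc : ℝ
  T₀ : ℝ
  Mz : ℝ
  MT : ℝ
  heps : 0 < eps
  hepsom : eps < om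
  hU₁pos : 0 < U₁
  hU₁₂ : U₁ ≤ U₂
  hUsmooth : ContDiffOn ℝ 2 (fun p : ℝ × ℝ => U p.1 p.2) (Icc eps om ×ˢ Icc eps om)
  hUlb : ∀ x ∈ Icc eps om, ∀ ξ ∈ Icc eps om, U₁ ≤ U x ξ
  hUub : ∀ x ∈ Icc eps om, ∀ ξ ∈ Icc eps om, U x ξ ≤ U₂
  hUmax : IsGreatest (Set.image2 U (Icc eps om) (Icc eps om)) Umax
  hUmin : IsLeast (Set.image2 U (Icc eps om) (Icc eps om)) Umin
  ha : a = (Umax / Umin) ^ 2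
  htau₁pos : 0 < tau₁
  htau₂pos : 0 < tau₂
  htau₁ : 1 = U₁ * (∫ ξ in eps..om, Real.tanh (ξ / (2 * tau₁)) / ξ)
  htau₂ : 1 = U₂ * (∫ ξ in eps..om, Real.tanh (ξ / (2 * tau₂)) / ξ)
  hΔ₁nonneg : ∀ T, 0 ≤ Δ₁ T
  hΔ₂nonneg : ∀ T, 0 ≤ Δ₂ T
  hΔ₁cont : Continuous Δ₁
  hΔ₂cont : Continuous Δ₂
  hΔ₁anti : StrictAntiOn Δ₁ (Icc 0 tau₁)
  hΔ₂anti : StrictAntiOn Δ₂ (Icc 0 tau₂)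
  hΔ₁eq : ∀ T ∈ Ioc 0 tau₁, U₁ * (∫ ξ in eps..om,
      Real.tanh (Real.sqrt (ξ ^ 2 + Δ₁ T ^ 2) / (2 * T)) / Real.sqrt (ξ ^ 2 + Δ₁ T ^ 2)) = 1
  hΔ₂eq : ∀ T ∈ Ioc 0 tau₂, U₂ * (∫ ξ in eps..om,
      Real.tanh (Real.sqrt (ξ ^ 2 + Δ₂ T ^ 2) / (2 * T)) / Real.sqrt (ξ ^ 2 + Δ₂ T ^ 2)) = 1
  hΔ₁zero : ∀ T, tau₁ ≤ T → Δ₁ T = 0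
  hΔ₂zero : ∀ T, tau₂ ≤ T → Δ₂ T = 0
  hTc₁ : tau₁ ≤ Tc
  hTc₂ : Tc ≤ tau₂
  hT₀₁ : tau₁ < T₀
  hT₀₂ : T₀ < Tc
  hMz : IsGreatest ((fun z => z / Real.cosh z) '' Set.Ici (0 : ℝ)) Mz
  hMT : MT = 4 * a * U₂ * Mz ^ 2 /
      (eps * U₁ *
        (Real.tanh (eps / (2 * Tc)) - (eps / (2 * Tc)) / Real.cosh (eps / (2 * Tc)) ^ 2) *
        (∫ ξ in eps..om, (ξ ^ 2 + Δ₂ 0 ^ 2) ^ (-(3 : ℝ) / 2)))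

namespace BCSContext

/-- The energy interval `I = [ε, ℏω_D]`. -/
def Iset (C : BCSContext) : Set ℝ := Icc C.eps C.om

/-- The rectangle `D = [T₀, T_c] × I`. -/
def Dset (C : BCSContext) : Set (ℝ × ℝ) := Icc C.T₀ C.Tc ×ˢ Icc C.eps C.om

end BCSContext

/-- The operator `A` of the squared BCS-Bogoliubov gap equation. -/
def opA (C : BCSContext) (f : ℝ → ℝ → ℝ) (T x : ℝ) : ℝ :=
  (∫ ξ in C.eps..C.om, C.U x ξ * Real.sqrt (f T ξ / (ξ ^ 2 + f T ξ)) *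
      Real.tanh (Real.sqrt (ξ ^ 2 + f T ξ) / (2 * T))) ^ 2

/-- Partial derivative with respect to the temperature `T` (within `[T₀, T_c]`). -/
def pderivT (C : BCSContext) (g : ℝ → ℝ → ℝ) (T x : ℝ) : ℝ :=
  derivWithin (fun s => g s x) (Icc C.T₀ C.Tc) T

/-- Partial derivative with respect to the energy `x` (within `I = [ε, ℏω_D]`). -/
def pderivX (C : BCSContext) (g : ℝ → ℝ → ℝ) (T x : ℝ) : ℝ :=
  derivWithin (fun y => g T y) (Icc C.eps C.om) x

/-- Membership in the set `W`. -/
def memW (C : BCSContext) (f : ℝ → ℝ → ℝ) : Prop :=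
  ContDiffOn ℝ 2 (fun p : ℝ × ℝ => f p.1 p.2) C.Dset ∧
  (∀ T ∈ Icc C.T₀ C.Tc, ∀ x ∈ C.Iset, C.Δ₁ T ^ 2 ≤ f T x ∧ f T x ≤ C.Δ₂ T ^ 2) ∧
  (∀ x ∈ C.Iset, f C.Tc x = 0) ∧
  (∀ T ∈ Ico C.T₀ C.Tc, ∀ x ∈ C.Iset, ∀ x₁ ∈ C.Iset, f T x ≤ C.a * f T x₁) ∧
  (∀ x ∈ C.Iset, ∀ x₁ ∈ C.Iset,
      -(pderivT C f C.Tc x) ≤ C.a * -(pderivT C f C.Tc x₁)) ∧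
  (∀ T ∈ Icc C.T₀ C.Tc, ∀ x ∈ C.Iset, pderivT C f T x < 0) ∧
  (∀ T ∈ Icc C.T₀ C.Tc, ∀ x ∈ C.Iset, -(pderivT C f T x) ≤ C.MT)

/-- The condition `a^{1/4} · max_{(T,x) ∈ D} ∫_I (U(x,ξ)/ξ) tanh(ξ/(2T)) dξ ≤ 1`. -/
def gapCondition (C : BCSContext) : Prop :=
  ∀ T ∈ Icc C.T₀ C.Tc, ∀ x ∈ C.Iset,
    C.a ^ ((1 : ℝ) / 4) * (∫ ξ in C.eps..C.om, C.U x ξ / ξ * Real.tanh (ξ / (2 * T))) ≤ 1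

instance (C : BCSContext) : CompactSpace ↥C.Dset :=
  isCompact_iff_compactSpace.mp (isCompact_Icc.prod isCompact_Icc)

-- Extension of a continuous function on `D` to a function on `ℝ × ℝ` (by `0` outside `D`).
open Classical in
def extFun (C : BCSContext) (F : C(↥C.Dset, ℝ)) : ℝ → ℝ → ℝ :=
  fun T x => if h : (T, x) ∈ C.Dset then F ⟨(T, x), h⟩ else 0

/-- The set `W` regarded as a subset of the Banach space `C(D)`. -/
def WSet (C : BCSContext) : Set C(↥C.Dset, ℝ) :=
  {F | ∃ f : ℝ → ℝ → ℝ, memW C f ∧ ∀ p : ↥C.Dset, F p = f (p : ℝ × ℝ).1 (p : ℝ × ℝ).2}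

/-- Differentiation under the integral sign on a convex set with unique derivatives. -/
theorem contDiffOn_one_intervalIntegral_param {E : Type*} [NormedAddCommGroup E]
    [NormedSpace ℝ E] {S : Set E} {K : E → ℝ → ℝ} {a b : ℝ} (hab : a < b) (hS : Convex ℝ S)
    (hSu : UniqueDiffOn ℝ S)
    (hK : ContDiffOn ℝ 1 (fun q : E × ℝ => K q.1 q.2) (S ×ˢ Icc a b)) :
    ContDiffOn ℝ 1 (fun p => ∫ t in a..b, K p t) S := by
  have hu : UniqueDiffOn ℝ (S ×ˢ Icc a b) := hSu.prod (uniqueDiffOn_Icc hab)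
  set K' : E → ℝ → (E →L[ℝ] ℝ) := fun p t =>
    (fderivWithin ℝ (fun q : E × ℝ => K q.1 q.2) (S ×ˢ Icc a b) (p, t)).comp
      (ContinuousLinearMap.inl ℝ E ℝ) with hK'
  have hK'c : ContinuousOn K'.uncurry (S ×ˢ Icc a b) :=
    (hK.continuousOn_fderivWithin hu le_rfl).clm_comp continuousOn_const
  have hd : ∀ p ∈ S, ∀ t ∈ Icc a b, HasFDerivWithinAt (fun p => K p t) (K' p t) S p := by
    intro p hp t ht
    have h1 := (hK.differentiableOn one_ne_zero (p, t) ⟨hp, ht⟩).hasFDerivWithinAt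
    have h2 : HasFDerivWithinAt (fun p : E => (p, t)) (ContinuousLinearMap.inl ℝ E ℝ) S p :=
      (hasFDerivAt_prodMk_left p t).hasFDerivWithinAt
    exact h1.comp (t := S ×ˢ Icc a b) p h2 (fun q hq => ⟨hq, ht⟩)
  have hint : ∀ p ∈ S, IntervalIntegrable (K p) volume a b := fun p hp => by
    refine ContinuousOn.intervalIntegrable_of_Icc hab.le ?_
    exact hK.continuousOn.comp (f := fun t => (p, t)) (by fun_prop) (fun t ht => ⟨hp, ht⟩)
  have hint' : ∀ p ∈ S, IntervalIntegrable (K' p) volume a b := fun p hp => by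
    refine ContinuousOn.intervalIntegrable_of_Icc hab.le ?_
    exact hK'c.comp (f := fun t => (p, t)) (by fun_prop) (fun t ht => ⟨hp, ht⟩)
  have hunif : ∀ p ∈ S, ∀ ε > 0, ∃ δ > 0, ∀ q ∈ S, dist q p < δ →
      ∀ t ∈ Icc a b, ‖K' q t - K' p t‖ ≤ ε := by
    intro p hp ε hε
    obtain ⟨v, hv, hv'⟩ := isCompact_Icc.mem_uniformity_of_prod hK'c hp
      (Metric.dist_mem_uniformity hε)
    obtain ⟨δ, hδ, hδv⟩ := Metric.mem_nhdsWithin_iff.1 hv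
    refine ⟨δ, hδ, fun q hq hqp t ht => ?_⟩
    have := hv' q (hδv ⟨hqp, hq⟩) t ht
    rw [← dist_eq_norm]
    exact le_of_lt this
  have hmemI : ∀ t ∈ Set.uIoc a b, t ∈ Icc a b := fun t ht => by
    rw [uIoc_of_le hab.le] at ht
    exact Ioc_subset_Icc_self ht
  have hba : 0 < b - a := sub_pos.2 hab
  have key : ContDiffOn ℝ (0 + 1) (fun p => ∫ t in a..b, K p t) S := by
    rw [contDiffOn_succ_iff_hasFDerivWithinAt_of_uniqueDiffOn hSu]
    refine ⟨by simp, fun p => ∫ t in a..b, K' p t, ?_, fun p hp => ?_⟩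
    · rw [contDiffOn_zero]
      refine Metric.continuousOn_iff.2 fun p hp ε hε => ?_
      obtain ⟨δ, hδ, h⟩ := hunif p hp (ε / (2 * (b - a))) (by positivity)
      refine ⟨δ, hδ, fun q hq hqp => ?_⟩
      rw [dist_eq_norm, ← intervalIntegral.integral_sub (hint' q hq) (hint' p hp)]
      refine (intervalIntegral.norm_integral_le_of_norm_le_const
        fun t ht => h q hq hqp t (hmemI t ht)).trans_lt ?_
      rw [abs_of_pos hba]
      field_simp
      linarith
    · rw [hasFDerivWithinAt_iff_isLittleO, Asymptotics.isLittleO_iff]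
      intro ε hε
      obtain ⟨δ, hδ, h⟩ := hunif p hp (ε / (b - a)) (by positivity)
      filter_upwards [inter_mem_nhdsWithin S (Metric.ball_mem_nhds p hδ)] with q hq
      have hev : (∫ t in a..b, K' p t) (q - p) = ∫ t in a..b, K' p t (q - p) :=
        ContinuousLinearMap.intervalIntegral_apply (hint' p hp) (q - p)
      have hint'' : IntervalIntegrable (fun t => K' p t (q - p)) volume a b := by
        refine ContinuousOn.intervalIntegrable_of_Icc hab.le ?_
        have : ContinuousOn (K' p) (Icc a b) :=
          hK'c.comp (f := fun t => (p, t)) (by fun_prop) (fun t ht => ⟨hp, ht⟩)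
        exact this.clm_apply continuousOn_const
      rw [hev, ← intervalIntegral.integral_sub (hint q hq.1) (hint p hp),
        ← intervalIntegral.integral_sub ((hint q hq.1).sub (hint p hp)) hint'']
      refine (intervalIntegral.norm_integral_le_of_norm_le_const (C := ε / (b - a) * ‖q - p‖)
        fun t ht => ?_).trans ?_
      · exact (hS.inter (convex_ball p δ)).norm_image_sub_le_of_norm_hasFDerivWithin_le'
          (fun r hr => (hd r hr.1 t (hmemI t ht)).mono inter_subset_left)
          (fun r hr => h r hr.1 hr.2 t (hmemI t ht)) ⟨hp, Metric.mem_ball_self hδ⟩ hq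
      · rw [abs_of_pos hba]
        apply le_of_eq
        field_simp
  simpa using key

theorem contDiff_tanh {n : WithTop ℕ∞} : ContDiff ℝ n Real.tanh := by
  have : Real.tanh = fun x => Real.sinh x / Real.cosh x :=
    funext Real.tanh_eq_sinh_div_cosh
  rw [this]
  exact Real.contDiff_sinh.div Real.contDiff_cosh fun x => (Real.cosh_pos x).ne'

namespace BCSContext

variable (C : BCSContext)

theorem T₀_pos : 0 < C.T₀ := C.htau₁pos.trans C.hT₀₁

theorem convex_Dset : Convex ℝ C.Dset := (convex_Icc _ _).prod (convex_Icc _ _)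

theorem uniqueDiffOn_Dset : UniqueDiffOn ℝ C.Dset :=
  (uniqueDiffOn_Icc C.hT₀₂).prod (uniqueDiffOn_Icc C.hepsom)

variable {C}

theorem hasDerivWithinAt_fst {g : ℝ → ℝ → ℝ}
    (hg : ContDiffOn ℝ 1 (fun p : ℝ × ℝ => g p.1 p.2) C.Dset) {T x : ℝ}
    (hT : T ∈ Icc C.T₀ C.Tc) (hx : x ∈ Icc C.eps C.om) :
    HasDerivWithinAt (fun s => g s x)
      (fderivWithin ℝ (fun p : ℝ × ℝ => g p.1 p.2) C.Dset (T, x) (1, 0)) (Icc C.T₀ C.Tc) T := by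
  have h1 := (hg.differentiableOn one_ne_zero (T, x) ⟨hT, hx⟩).hasFDerivWithinAt
  have h2 : HasDerivWithinAt (fun s : ℝ => (s, x)) ((1 : ℝ), (0 : ℝ)) (Icc C.T₀ C.Tc) T :=
    (hasDerivWithinAt_id T _).prodMk (hasDerivWithinAt_const T _ x)
  exact h1.comp_hasDerivWithinAt (t := C.Dset) T h2 (fun s hs => ⟨hs, hx⟩)

theorem hasDerivWithinAt_snd {g : ℝ → ℝ → ℝ}
    (hg : ContDiffOn ℝ 1 (fun p : ℝ × ℝ => g p.1 p.2) C.Dset) {T x : ℝ}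
    (hT : T ∈ Icc C.T₀ C.Tc) (hx : x ∈ Icc C.eps C.om) :
    HasDerivWithinAt (fun y => g T y)
      (fderivWithin ℝ (fun p : ℝ × ℝ => g p.1 p.2) C.Dset (T, x) (0, 1)) (Icc C.eps C.om) x := by
  have h1 := (hg.differentiableOn one_ne_zero (T, x) ⟨hT, hx⟩).hasFDerivWithinAt
  have h2 : HasDerivWithinAt (fun y : ℝ => (T, y)) ((0 : ℝ), (1 : ℝ)) (Icc C.eps C.om) x :=
    (hasDerivWithinAt_const x _ T).prodMk (hasDerivWithinAt_id x _)
  exact h1.comp_hasDerivWithinAt (t := C.Dset) x h2 (fun s hs => ⟨hT, hs⟩)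

theorem pderivT_eq_fderivWithin {g : ℝ → ℝ → ℝ}
    (hg : ContDiffOn ℝ 1 (fun p : ℝ × ℝ => g p.1 p.2) C.Dset) {T x : ℝ}
    (hT : T ∈ Icc C.T₀ C.Tc) (hx : x ∈ Icc C.eps C.om) :
    pderivT C g T x = fderivWithin ℝ (fun p : ℝ × ℝ => g p.1 p.2) C.Dset (T, x) (1, 0) :=
  (hasDerivWithinAt_fst hg hT hx).derivWithin (uniqueDiffOn_Icc C.hT₀₂ T hT)

theorem pderivX_eq_fderivWithin {g : ℝ → ℝ → ℝ}
    (hg : ContDiffOn ℝ 1 (fun p : ℝ × ℝ => g p.1 p.2) C.Dset) {T x : ℝ}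
    (hT : T ∈ Icc C.T₀ C.Tc) (hx : x ∈ Icc C.eps C.om) :
    pderivX C g T x = fderivWithin ℝ (fun p : ℝ × ℝ => g p.1 p.2) C.Dset (T, x) (0, 1) :=
  (hasDerivWithinAt_snd hg hT hx).derivWithin (uniqueDiffOn_Icc C.hepsom x hx)

theorem continuousOn_pderivT {g : ℝ → ℝ → ℝ}
    (hg : ContDiffOn ℝ 1 (fun p : ℝ × ℝ => g p.1 p.2) C.Dset) :
    ContinuousOn (fun p : ℝ × ℝ => pderivT C g p.1 p.2) C.Dset :=
  ((hg.continuousOn_fderivWithin C.uniqueDiffOn_Dset le_rfl).clm_apply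
    continuousOn_const).congr fun _ hp => pderivT_eq_fderivWithin hg hp.1 hp.2

theorem continuousOn_pderivX {g : ℝ → ℝ → ℝ}
    (hg : ContDiffOn ℝ 1 (fun p : ℝ × ℝ => g p.1 p.2) C.Dset) :
    ContinuousOn (fun p : ℝ × ℝ => pderivX C g p.1 p.2) C.Dset :=
  ((hg.continuousOn_fderivWithin C.uniqueDiffOn_Dset le_rfl).clm_apply
    continuousOn_const).congr fun _ hp => pderivX_eq_fderivWithin hg hp.1 hp.2

theorem contDiffOn_pderivT {g : ℝ → ℝ → ℝ}
    (hg : ContDiffOn ℝ 2 (fun p : ℝ × ℝ => g p.1 p.2) C.Dset) :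
    ContDiffOn ℝ 1 (fun p : ℝ × ℝ => pderivT C g p.1 p.2) C.Dset :=
  ((hg.fderivWithin C.uniqueDiffOn_Dset (m := 1) (by norm_num)).clm_apply
    contDiffOn_const).congr
    fun _ hp => pderivT_eq_fderivWithin (hg.of_le one_le_two) hp.1 hp.2

variable (C) in
/-- The mean of `-f_T` over `[T, T_c]`; when `f(T_c, x) = 0` it is the quotient
`f(T, x) / (T_c - T)`, extended continuously to `T = T_c`. -/
def meanSlope (f : ℝ → ℝ → ℝ) (T x : ℝ) : ℝ :=
  ∫ s in (0 : ℝ)..1, -pderivT C f (T + s * (C.Tc - T)) x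

theorem segment_mem {T s : ℝ} (hT : T ∈ Icc C.T₀ C.Tc) (hs : s ∈ Icc (0 : ℝ) 1) :
    T + s * (C.Tc - T) ∈ Icc C.T₀ C.Tc := by
  obtain ⟨h1, h2⟩ := hT
  obtain ⟨h3, h4⟩ := hs
  constructor <;> nlinarith

theorem contDiffOn_meanSlope {f : ℝ → ℝ → ℝ}
    (hf : ContDiffOn ℝ 2 (fun p : ℝ × ℝ => f p.1 p.2) C.Dset) :
    ContDiffOn ℝ 1 (fun p : ℝ × ℝ => meanSlope C f p.1 p.2) C.Dset := by
  refine contDiffOn_one_intervalIntegral_param (S := C.Dset) one_pos C.convex_Dset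
    C.uniqueDiffOn_Dset
    (K := fun p s => -pderivT C f (p.1 + s * (C.Tc - p.1)) p.2) ?_
  refine ContDiffOn.neg ?_
  refine (contDiffOn_pderivT hf).comp
    (f := fun q : (ℝ × ℝ) × ℝ => (q.1.1 + q.2 * (C.Tc - q.1.1), q.1.2))
    (ContDiff.contDiffOn (by fun_prop)) ?_
  rintro ⟨p, s⟩ ⟨hp, hs⟩
  exact ⟨segment_mem hp.1 hs, hp.2⟩

theorem meanSlope_Tc (f : ℝ → ℝ → ℝ) (x : ℝ) : meanSlope C f C.Tc x = -pderivT C f C.Tc x := by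
  simp [meanSlope]

theorem continuousOn_pderivT_segment {f : ℝ → ℝ → ℝ}
    (hf : ContDiffOn ℝ 1 (fun p : ℝ × ℝ => f p.1 p.2) C.Dset) {T x : ℝ}
    (hT : T ∈ Icc C.T₀ C.Tc) (hx : x ∈ Icc C.eps C.om) :
    ContinuousOn (fun s => pderivT C f (T + s * (C.Tc - T)) x) (Icc 0 1) :=
  (continuousOn_pderivT hf).comp (f := fun s : ℝ => (T + s * (C.Tc - T), x))
    (by fun_prop) fun _ hs => ⟨segment_mem hT hs, hx⟩

theorem meanSlope_pos {f : ℝ → ℝ → ℝ}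
    (hf : ContDiffOn ℝ 1 (fun p : ℝ × ℝ => f p.1 p.2) C.Dset) {T x : ℝ}
    (hneg : ∀ T ∈ Icc C.T₀ C.Tc, pderivT C f T x < 0)
    (hT : T ∈ Icc C.T₀ C.Tc) (hx : x ∈ Icc C.eps C.om) : 0 < meanSlope C f T x := by
  refine intervalIntegral.intervalIntegral_pos_of_pos_on
    (ContinuousOn.intervalIntegrable_of_Icc zero_le_one
      (continuousOn_pderivT_segment hf hT hx).neg) ?_ one_pos
  exact fun s hs => neg_pos.2 (hneg _ (segment_mem hT (Ioo_subset_Icc_self hs)))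

theorem eq_mul_meanSlope {f : ℝ → ℝ → ℝ}
    (hf : ContDiffOn ℝ 1 (fun p : ℝ × ℝ => f p.1 p.2) C.Dset) {T x : ℝ}
    (hf0 : f C.Tc x = 0) (hT : T ∈ Icc C.T₀ C.Tc) (hx : x ∈ Icc C.eps C.om) :
    f T x = (C.Tc - T) * meanSlope C f T x := by
  have hd : ∀ s ∈ Icc (0 : ℝ) 1, HasDerivWithinAt (fun s => f (T + s * (C.Tc - T)) x)
      (pderivT C f (T + s * (C.Tc - T)) x * (C.Tc - T)) (Icc 0 1) s := by
    intro s hs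
    have h1 : HasDerivWithinAt (fun s : ℝ => T + s * (C.Tc - T)) (C.Tc - T) (Icc 0 1) s := by
      simpa using (((hasDerivAt_id s).mul_const (C.Tc - T)).const_add T).hasDerivWithinAt
    have h2 := hasDerivWithinAt_fst hf (segment_mem hT hs) hx
    rw [← pderivT_eq_fderivWithin hf (segment_mem hT hs) hx] at h2
    exact h2.comp s h1 fun u hu => segment_mem hT hu
  have key := intervalIntegral.integral_eq_sub_of_hasDerivAt_of_le zero_le_one
    (fun s hs => (hd s hs).continuousWithinAt)
    (fun s hs => (hd s (Ioo_subset_Icc_self hs)).hasDerivAt (Icc_mem_nhds hs.1 hs.2))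
    (ContinuousOn.intervalIntegrable_of_Icc zero_le_one
      ((continuousOn_pderivT_segment hf hT hx).mul continuousOn_const))
  simp only [intervalIntegral.integral_mul_const] at key
  simp only [meanSlope, intervalIntegral.integral_neg]
  simp [hf0] at key
  linarith

variable (C) in
/-- The square root of `opA` with the factor `√(T_c - T)` removed. -/
def reducedInt (f : ℝ → ℝ → ℝ) (T x : ℝ) : ℝ :=
  ∫ ξ in C.eps..C.om, C.U x ξ * (Real.sqrt (meanSlope C f T ξ / (ξ ^ 2 + f T ξ)) *
    Real.tanh (Real.sqrt (ξ ^ 2 + f T ξ) / (2 * T)))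

theorem opA_eq_mul_sq {f : ℝ → ℝ → ℝ}
    (hfac : ∀ T ∈ Icc C.T₀ C.Tc, ∀ x ∈ Icc C.eps C.om, f T x = (C.Tc - T) * meanSlope C f T x)
    {T : ℝ} (hT : T ∈ Icc C.T₀ C.Tc) (x : ℝ) :
    opA C f T x = (C.Tc - T) * reducedInt C f T x ^ 2 := by
  have h : (∫ ξ in C.eps..C.om, C.U x ξ * Real.sqrt (f T ξ / (ξ ^ 2 + f T ξ)) *
      Real.tanh (Real.sqrt (ξ ^ 2 + f T ξ) / (2 * T))) =
      Real.sqrt (C.Tc - T) * reducedInt C f T x := by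
    rw [reducedInt, ← intervalIntegral.integral_const_mul]
    refine intervalIntegral.integral_congr fun ξ hξ => ?_
    rw [uIcc_of_le C.hepsom.le] at hξ
    have h1 : Real.sqrt (f T ξ / (ξ ^ 2 + f T ξ)) =
        Real.sqrt (C.Tc - T) * Real.sqrt (meanSlope C f T ξ / (ξ ^ 2 + f T ξ)) := by
      rw [← Real.sqrt_mul (sub_nonneg.2 hT.2), ← mul_div_assoc, ← hfac T hT ξ hξ]
    simp only [h1]
    ring
  rw [opA, h, mul_pow, Real.sq_sqrt (sub_nonneg.2 hT.2)]

theorem contDiffOn_reducedInt {f : ℝ → ℝ → ℝ}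
    (hf : ContDiffOn ℝ 2 (fun p : ℝ × ℝ => f p.1 p.2) C.Dset)
    (hnonneg : ∀ T ∈ Icc C.T₀ C.Tc, ∀ x ∈ Icc C.eps C.om, 0 ≤ f T x)
    (hpos : ∀ T ∈ Icc C.T₀ C.Tc, ∀ x ∈ Icc C.eps C.om, 0 < meanSlope C f T x) :
    ContDiffOn ℝ 1 (fun p : ℝ × ℝ => reducedInt C f p.1 p.2) C.Dset := by
  have hden : ∀ p ∈ C.Dset, 0 < p.2 ^ 2 + f p.1 p.2 := fun p hp =>
    add_pos_of_pos_of_nonneg (pow_pos (C.heps.trans_le hp.2.1) 2) (hnonneg _ hp.1 _ hp.2)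
  have hsum : ContDiffOn ℝ 1 (fun p : ℝ × ℝ => p.2 ^ 2 + f p.1 p.2) C.Dset :=
    (contDiff_snd.pow 2).contDiffOn.add (hf.of_le one_le_two)
  have hH : ContDiffOn ℝ 1 (fun p : ℝ × ℝ => Real.sqrt (meanSlope C f p.1 p.2 /
      (p.2 ^ 2 + f p.1 p.2)) * Real.tanh (Real.sqrt (p.2 ^ 2 + f p.1 p.2) / (2 * p.1)))
      C.Dset := by
    refine ContDiffOn.mul ?_ (contDiff_tanh.comp_contDiffOn ?_)
    · exact ((contDiffOn_meanSlope hf).div hsum fun p hp => (hden p hp).ne').sqrt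
        fun p hp => (div_pos (hpos _ hp.1 _ hp.2) (hden p hp)).ne'
    · refine (hsum.sqrt fun p hp => (hden p hp).ne').div
        (contDiff_const.mul contDiff_fst).contDiffOn fun p hp => ?_
      have : 0 < p.1 := C.T₀_pos.trans_le hp.1.1
      positivity
  refine contDiffOn_one_intervalIntegral_param (S := C.Dset) C.hepsom C.convex_Dset
    C.uniqueDiffOn_Dset
    (K := fun p ξ => C.U p.2 ξ * (Real.sqrt (meanSlope C f p.1 ξ / (ξ ^ 2 + f p.1 ξ)) *
      Real.tanh (Real.sqrt (ξ ^ 2 + f p.1 ξ) / (2 * p.1)))) (ContDiffOn.mul ?_ ?_)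
  · exact (C.hUsmooth.of_le one_le_two).comp (f := fun q : (ℝ × ℝ) × ℝ => (q.1.2, q.2))
      (ContDiff.contDiffOn (by fun_prop)) fun q hq => ⟨hq.1.2, hq.2⟩
  · exact hH.comp (f := fun q : (ℝ × ℝ) × ℝ => (q.1.1, q.2))
      (ContDiff.contDiffOn (by fun_prop)) fun q hq => ⟨hq.1.1, hq.2⟩

theorem reducedInt_Tc {f : ℝ → ℝ → ℝ} (hf0 : ∀ x ∈ Icc C.eps C.om, f C.Tc x = 0) (x : ℝ) :
    reducedInt C f C.Tc x = ∫ ξ in C.eps..C.om,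
      C.U x ξ * (Real.sqrt (-(pderivT C f C.Tc ξ)) / ξ) * Real.tanh (ξ / (2 * C.Tc)) := by
  refine intervalIntegral.integral_congr fun ξ hξ => ?_
  rw [uIcc_of_le C.hepsom.le] at hξ
  have hξ0 : 0 ≤ ξ := C.heps.le.trans hξ.1
  simp only [meanSlope_Tc, hf0 ξ hξ, add_zero, Real.sqrt_div' _ (sq_nonneg ξ), Real.sqrt_sq hξ0]
  ring

end BCSContext

open BCSContext

theorem stmt_6 (C : BCSContext) (f : ℝ → ℝ → ℝ) (hf : memW C f) :
    (∀ T ∈ Icc C.T₀ C.Tc, ∀ x ∈ C.Iset,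
        DifferentiableWithinAt ℝ (fun s => opA C f s x) (Icc C.T₀ C.Tc) T ∧
        DifferentiableWithinAt ℝ (fun y => opA C f T y) (Icc C.eps C.om) x) ∧
    ContinuousOn (fun p : ℝ × ℝ => pderivT C (opA C f) p.1 p.2) C.Dset ∧
    ContinuousOn (fun p : ℝ × ℝ => pderivX C (opA C f) p.1 p.2) C.Dset ∧
    ContDiffOn ℝ 1 (fun p : ℝ × ℝ => opA C f p.1 p.2) C.Dset ∧
    (∀ x ∈ C.Iset, pderivT C (opA C f) C.Tc x =
      -((∫ ξ in C.eps..C.om, C.U x ξ * (Real.sqrt (-(pderivT C f C.Tc ξ)) / ξ) *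
          Real.tanh (ξ / (2 * C.Tc))) ^ 2)) := by
  obtain ⟨hf2, hΔ, hf0, -, -, hneg, -⟩ := hf
  have hf1 := hf2.of_le one_le_two
  have hfac : ∀ T ∈ Icc C.T₀ C.Tc, ∀ x ∈ Icc C.eps C.om, f T x = (C.Tc - T) * meanSlope C f T x :=
    fun T hT x hx => eq_mul_meanSlope hf1 (hf0 x hx) hT hx
  have hG := contDiffOn_reducedInt hf2 (fun T hT x hx => (sq_nonneg _).trans (hΔ T hT x hx).1)
    fun T hT x hx => meanSlope_pos hf1 (fun T hT => hneg T hT x hx) hT hx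
  have hA : ContDiffOn ℝ 1 (fun p : ℝ × ℝ => opA C f p.1 p.2) C.Dset :=
    ((contDiff_const.sub contDiff_fst).contDiffOn.mul (hG.pow 2)).congr
      fun p hp => opA_eq_mul_sq hfac hp.1 p.2
  refine ⟨fun T hT x hx => ⟨(hasDerivWithinAt_fst hA hT hx).differentiableWithinAt,
    (hasDerivWithinAt_snd hA hT hx).differentiableWithinAt⟩, continuousOn_pderivT hA,
    continuousOn_pderivX hA, hA, fun x hx => ?_⟩
  have hTc : C.Tc ∈ Icc C.T₀ C.Tc := right_mem_Icc.2 C.hT₀₂.le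
  have hd := ((hasDerivWithinAt_id C.Tc (Icc C.T₀ C.Tc)).const_sub C.Tc).mul
    ((hasDerivWithinAt_fst hG hTc hx).pow 2)
  have hd' := (hd.congr (fun T hT => opA_eq_mul_sq hfac hT x)
    (opA_eq_mul_sq hfac hTc x)).derivWithin (uniqueDiffOn_Icc C.hT₀₂ _ hTc)
  rw [pderivT, hd', ← reducedInt_Tc hf0]
  simp


end
end

section
/- For every f ∈ W and every (T,x) ∈ D, one has Δ₁(T)² ≤ Af(T,x) ≤ Δ₂(T)². -/
open Set MeasureTheory Filter Topology

noncomputable section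

theorem Real.tanh_mono : Monotone Real.tanh := by
  intro x y h
  rw [Real.tanh_eq_sinh_div_cosh, Real.tanh_eq_sinh_div_cosh,
    div_le_div_iff₀ (Real.cosh_pos x) (Real.cosh_pos y)]
  have h₁ : 0 ≤ Real.sinh (y - x) := Real.sinh_nonneg_iff.mpr (sub_nonneg.mpr h)
  rw [Real.sinh_sub] at h₁
  linarith

theorem Real.tanh_nonneg_of_nonneg {x : ℝ} (h : 0 ≤ x) : 0 ≤ Real.tanh x := by
  rw [Real.tanh_eq_sinh_div_cosh]
  exact div_nonneg (Real.sinh_nonneg_iff.mpr h) (Real.cosh_pos x).le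

theorem Real.continuous_tanh_real : Continuous Real.tanh := by
  rw [funext Real.tanh_eq_sinh_div_cosh]
  exact Real.continuous_sinh.div Real.continuous_cosh fun x => (Real.cosh_pos x).ne'

/-- The ratio `√(t / (ξ² + t))` is at most `d / √(ξ² + d²)` when `0 ≤ t ≤ d²`. -/
theorem sqrt_div_sq_add_le {ξ t d : ℝ} (hξ : 0 < ξ) (ht : 0 ≤ t) (hd : 0 ≤ d)
    (htd : t ≤ d ^ 2) :
    Real.sqrt (t / (ξ ^ 2 + t)) ≤ d / Real.sqrt (ξ ^ 2 + d ^ 2) := by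
  have h : d / Real.sqrt (ξ ^ 2 + d ^ 2) = Real.sqrt (d ^ 2 / (ξ ^ 2 + d ^ 2)) := by
    rw [Real.sqrt_div (sq_nonneg d), Real.sqrt_sq hd]
  rw [h]
  apply Real.sqrt_le_sqrt
  rw [div_le_div_iff₀ (by positivity) (by positivity)]
  nlinarith [mul_le_mul_of_nonneg_left htd (sq_nonneg ξ)]

theorem stmt_8 (C : BCSContext) (f : ℝ → ℝ → ℝ) (hf : memW C f) :
    ∀ T ∈ Icc C.T₀ C.Tc, ∀ x ∈ C.Iset,
      C.Δ₁ T ^ 2 ≤ opA C f T x ∧ opA C f T x ≤ C.Δ₂ T ^ 2 := by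
  obtain ⟨hsm, hbd, -⟩ := hf
  intro T hT x hx
  have hT0 : 0 < T := by linarith [C.htau₁pos, C.hT₀₁, hT.1]
  refine ⟨?_, ?_⟩
  · rw [C.hΔ₁zero T (C.hT₀₁.le.trans hT.1), zero_pow two_ne_zero]
    exact sq_nonneg _
  have hpos : ∀ ξ ∈ Icc C.eps C.om, 0 < ξ := fun ξ hξ => C.heps.trans_le hξ.1
  have hf0 : ∀ ξ ∈ Icc C.eps C.om, 0 ≤ f T ξ := fun ξ hξ =>
    (sq_nonneg _).trans (hbd T hT ξ hξ).1
  have hden : ∀ ξ ∈ Icc C.eps C.om, 0 < ξ ^ 2 + f T ξ := fun ξ hξ =>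
    add_pos_of_pos_of_nonneg (pow_pos (hpos ξ hξ) 2) (hf0 ξ hξ)
  have hfc : ContinuousOn (fun ξ => f T ξ) (Icc C.eps C.om) :=
    hsm.continuousOn.comp (f := fun ξ => (T, ξ)) (by fun_prop) fun ξ hξ => ⟨hT, hξ⟩
  have hUc : ContinuousOn (fun ξ => C.U x ξ) (Icc C.eps C.om) :=
    C.hUsmooth.continuousOn.comp (f := fun ξ => (x, ξ)) (by fun_prop) fun ξ hξ => ⟨hx, hξ⟩
  have htanh := Real.continuous_tanh_real
  have hc : ContinuousOn (fun ξ => C.U x ξ * Real.sqrt (f T ξ / (ξ ^ 2 + f T ξ)) *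
      Real.tanh (Real.sqrt (ξ ^ 2 + f T ξ) / (2 * T))) (Icc C.eps C.om) := by
    have hq : ContinuousOn (fun ξ => ξ ^ 2 + f T ξ) (Icc C.eps C.om) := by fun_prop
    exact (hUc.mul (hfc.div hq fun ξ hξ => (hden ξ hξ).ne').sqrt).mul
      (htanh.comp_continuousOn (hq.sqrt.div_const _))
  have hden₂ : ∀ ξ ∈ Icc C.eps C.om, 0 < Real.sqrt (ξ ^ 2 + C.Δ₂ T ^ 2) := fun ξ hξ =>
    Real.sqrt_pos.mpr (add_pos_of_pos_of_nonneg (pow_pos (hpos ξ hξ) 2) (sq_nonneg _))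
  have hc₂ : ContinuousOn (fun ξ => C.Δ₂ T * (C.U₂ *
      (Real.tanh (Real.sqrt (ξ ^ 2 + C.Δ₂ T ^ 2) / (2 * T)) /
        Real.sqrt (ξ ^ 2 + C.Δ₂ T ^ 2)))) (Icc C.eps C.om) := by
    have hq : ContinuousOn (fun ξ => Real.sqrt (ξ ^ 2 + C.Δ₂ T ^ 2)) (Icc C.eps C.om) := by
      fun_prop
    exact continuousOn_const.mul (continuousOn_const.mul
      ((htanh.comp_continuousOn (hq.div_const _)).div hq fun ξ hξ => (hden₂ ξ hξ).ne'))
  have hle := C.hepsom.le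
  have htanh0 : ∀ ξ, 0 ≤ Real.tanh (Real.sqrt (ξ ^ 2 + f T ξ) / (2 * T)) := fun ξ =>
    Real.tanh_nonneg_of_nonneg (by positivity)
  have hU0 : ∀ ξ ∈ Icc C.eps C.om, 0 ≤ C.U x ξ := fun ξ hξ =>
    C.hU₁pos.le.trans (C.hUlb x hx ξ hξ)
  refine pow_le_pow_left₀ (intervalIntegral.integral_nonneg hle fun ξ hξ =>
    mul_nonneg (mul_nonneg (hU0 ξ hξ) (Real.sqrt_nonneg _)) (htanh0 ξ)) ?_ 2
  calc _ ≤ ∫ ξ in C.eps..C.om, C.Δ₂ T * (C.U₂ *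
        (Real.tanh (Real.sqrt (ξ ^ 2 + C.Δ₂ T ^ 2) / (2 * T)) /
          Real.sqrt (ξ ^ 2 + C.Δ₂ T ^ 2))) := by
        refine intervalIntegral.integral_mono_on hle (hc.intervalIntegrable_of_Icc hle)
          (hc₂.intervalIntegrable_of_Icc hle) fun ξ hξ => ?_
        have hfle := (hbd T hT ξ hξ).2
        have hU₂ : 0 ≤ C.U₂ := C.hU₁pos.le.trans C.hU₁₂
        calc _ ≤ C.U₂ * (C.Δ₂ T / Real.sqrt (ξ ^ 2 + C.Δ₂ T ^ 2)) *
              Real.tanh (Real.sqrt (ξ ^ 2 + C.Δ₂ T ^ 2) / (2 * T)) := by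
              have hΔ := C.hΔ₂nonneg T
              refine mul_le_mul (mul_le_mul (C.hUub x hx ξ hξ)
                (sqrt_div_sq_add_le (hpos ξ hξ) (hf0 ξ hξ) hΔ hfle)
                (Real.sqrt_nonneg _) hU₂) (Real.tanh_mono ?_) (htanh0 ξ) (by positivity)
              gcongr
          _ = _ := by ring
    _ = C.Δ₂ T := by
        rw [intervalIntegral.integral_const_mul, intervalIntegral.integral_const_mul,
          C.hΔ₂eq T ⟨hT0, hT.2.trans C.hTc₂⟩, mul_one]

end
end
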